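/- arXiv:1805.10661 — 2 statements merged into one kernel-verified Lean document; each statement's English description precedes it below -/
import Mathlib

section
/- Let L > 0 and let u, b : ℝ³ → ℝ³ be smooth functions that are L-periodic in each coordinate direction, with u divergence free, i.e., Σ_k ∂_k u_k(x) = 0 for all x. Then ∫_{[0,L]³} Σ_{k,l,m} u_k(x)·∂_k b_l(x)·∂_m∂_m b_l(x) dx = Σ_{k,l,m} ∫_{[0,L]³} ∂_m u_k(x)·∂_m∂_k b_l(x)·b_l(x) dx. -/
open MeasureTheory

/-- Partial derivative in direction `k`. -/
noncomputable def pd (k : Fin 3) (f : (Fin 3 → ℝ) → ℝ) : (Fin 3 → ℝ) → ℝ :=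
  fun x => fderiv ℝ f x (Pi.single k 1)

/-- Smooth and periodic scalar functions. -/
def SP (L : ℝ) (f : (Fin 3 → ℝ) → ℝ) : Prop :=
  ContDiff ℝ (⊤ : ℕ∞) f ∧ ∀ (x : Fin 3 → ℝ) (i : Fin 3), f (x + Pi.single i L) = f x

lemma SP.mul {L : ℝ} {f g : (Fin 3 → ℝ) → ℝ} (hf : SP L f) (hg : SP L g) :
    SP L (fun x => f x * g x) :=
  ⟨hf.1.mul hg.1, fun x i => by simp only [hf.2, hg.2]⟩

lemma SP.pd {L : ℝ} {f : (Fin 3 → ℝ) → ℝ} (hf : SP L f) (k : Fin 3) : SP L (pd k f) := by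
  refine ⟨?_, fun x i => ?_⟩
  · exact (hf.1.fderiv_right (m := (⊤ : ℕ∞)) (by simp)).clm_apply contDiff_const
  · have h : (fun y => f (y + Pi.single i L)) = f := funext fun y => hf.2 y i
    have h2 := fderiv_comp_add_right (𝕜 := ℝ) (f := f) (x := x) (Pi.single i L)
    rw [h] at h2
    simp only [_root_.pd, h2]

lemma SP.diff {L : ℝ} {f : (Fin 3 → ℝ) → ℝ} (hf : SP L f) : Differentiable ℝ f :=
  hf.1.differentiable (by simp)

lemma SP.int {L : ℝ} {f : (Fin 3 → ℝ) → ℝ} (hf : SP L f) :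
    IntegrableOn f (Set.Icc (0 : Fin 3 → ℝ) (fun _ => L)) :=
  hf.1.continuous.continuousOn.integrableOn_compact isCompact_Icc

lemma pd_mul {L : ℝ} {f g : (Fin 3 → ℝ) → ℝ} (hf : SP L f) (hg : SP L g) (k : Fin 3)
    (x : Fin 3 → ℝ) :
    pd k (fun x => f x * g x) x = pd k f x * g x + f x * pd k g x := by
  simp only [pd]
  rw [fderiv_fun_mul (hf.diff x) (hg.diff x)]
  simp
  ring

lemma pd_comm {L : ℝ} {f : (Fin 3 → ℝ) → ℝ} (hf : SP L f) (k m : Fin 3)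
    (x : Fin 3 → ℝ) : pd k (pd m f) x = pd m (pd k f) x := by
  have h1 : DifferentiableAt ℝ (fderiv ℝ f) x :=
    (hf.1.fderiv_right (m := (⊤ : ℕ∞)) (by simp)).differentiable (by simp) x
  have key : ∀ i j : Fin 3, pd i (pd j f) x
      = fderiv ℝ (fderiv ℝ f) x (Pi.single i 1) (Pi.single j 1) := by
    intro i j
    unfold pd
    rw [fderiv_clm_apply h1 (differentiableAt_const _)]
    simp
  rw [key, key]
  have hs : IsSymmSndFDerivAt ℝ f x :=
    (hf.1.contDiffAt).isSymmSndFDerivAt (by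
      simp only [minSmoothness_of_isRCLikeNormedField]
      exact WithTop.coe_le_coe.2 (le_top : (2 : ℕ∞) ≤ ⊤))
  exact hs _ _

lemma integral_pd {L : ℝ} (hL : 0 < L) {f : (Fin 3 → ℝ) → ℝ} (hf : SP L f) (k : Fin 3) :
    ∫ x in Set.Icc (0 : Fin 3 → ℝ) (fun _ => L), pd k f x = 0 := by
  have h := integral_divergence_of_hasFDerivAt_off_countable' (n := 2) (E := ℝ)
    (0 : Fin 3 → ℝ) (fun _ => L) (fun _ => hL.le)
    (fun i x => if i = k then f x else 0)
    (fun i x => if i = k then fderiv ℝ f x else 0) ∅ Set.countable_empty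
    (by
      intro i
      by_cases hi : i = k
      · simpa [hi] using hf.1.continuous.continuousOn
      · simpa [hi] using continuousOn_const)
    (by
      intro x _ i
      by_cases hi : i = k
      · simpa [hi] using (hf.diff x).hasFDerivAt
      · simpa [hi] using hasFDerivAt_const (0 : ℝ) x)
    (by
      have : (fun x => ∑ i, (if i = k then fderiv ℝ f x else 0) (Pi.single i 1)) = pd k f := by
        funext x
        rw [Finset.sum_eq_single k]
        · simp [pd]
        · intro i _ hi
          simp [hi]
        · simp
      rw [this]
      exact (hf.pd k).int)
  have h1 : ∀ x, ∑ i, (if i = k then fderiv ℝ f x else 0) (Pi.single i 1) = pd k f x := by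
    intro x
    rw [Finset.sum_eq_single k]
    · simp [pd]
    · intro i _ hi
      simp [hi]
    · simp
  simp only [h1] at h
  rw [h]
  refine Finset.sum_eq_zero fun i _ => ?_
  rw [sub_eq_zero]
  congr 1
  funext y
  by_cases hi : i = k
  · simp only [hi, if_true]
    refine Eq.trans ?_ (hf.2 (k.insertNth 0 y) k)
    congr 1
    funext j
    refine Fin.succAboveCases k ?_ (fun j => ?_) j
    · simp
    · simp
  · simp [hi]

lemma main_term {L : ℝ} (hL : 0 < L) (u : Fin 3 → (Fin 3 → ℝ) → ℝ) (b : (Fin 3 → ℝ) → ℝ)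
    (hu : ∀ k, SP L (u k)) (hb : SP L b) (hdiv : ∀ x, ∑ k, pd k (u k) x = 0) (m : Fin 3) :
    ∑ k, ∫ x in Set.Icc (0 : Fin 3 → ℝ) (fun _ => L), u k x * pd k b x * pd m (pd m b) x =
    ∑ k, ∫ x in Set.Icc (0 : Fin 3 → ℝ) (fun _ => L), pd m (u k) x * pd m (pd k b) x * b x := by
  have hdiv2 : ∀ x, ∑ k, pd m (pd k (u k)) x = 0 := by
    intro x
    have h0 : (fun y => ∑ k, pd k (u k) y) = fun _ => 0 := funext hdiv
    have h1 : fderiv ℝ (fun y => ∑ k, pd k (u k) y) x (Pi.single m 1) = 0 := by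
      rw [h0]; simp
    rw [fderiv_fun_sum (fun k _ => ((hu k).pd k).diff x)] at h1
    simpa [pd] using h1
  have hbm := hb.pd m
  -- the pieces
  have hA := fun k => ((hu k).mul (hb.pd k)).mul hbm
  have hB := fun k => (hu k).mul (hbm.mul hbm)
  have hC := fun k => ((hu k).pd m).mul (hbm.mul hb)
  have hE := fun k => ((hu k).pd k).mul (hbm.mul hbm)
  have hF := fun k => (((hu k).pd k).pd m).mul (hbm.mul hb)
  have hRk := fun k => (((hu k).pd m).mul ((hb.pd k).pd m)).mul hb
  have pt : ∀ k x, u k x * pd k b x * pd m (pd m b) x =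
      pd m (u k) x * pd m (pd k b) x * b x +
      (pd m (fun x => u k x * pd k b x * pd m b x) x
        - (1/2) * pd k (fun x => u k x * (pd m b x * pd m b x)) x
        - pd k (fun x => pd m (u k) x * (pd m b x * b x)) x
        + (1/2) * (pd k (u k) x * (pd m b x * pd m b x))
        + pd m (pd k (u k)) x * (pd m b x * b x)) := by
    intro k x
    rw [pd_mul ((hu k).mul (hb.pd k)) hbm, pd_mul (hu k) (hb.pd k),
      pd_mul (hu k) (hbm.mul hbm), pd_mul hbm hbm, pd_mul ((hu k).pd m) (hbm.mul hb),
      pd_mul hbm hb, pd_comm hb k m, pd_comm (hu k) k m]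
    ring
  have step : ∀ k, ∫ x in Set.Icc (0 : Fin 3 → ℝ) (fun _ => L),
        u k x * pd k b x * pd m (pd m b) x =
      (∫ x in Set.Icc (0 : Fin 3 → ℝ) (fun _ => L), pd m (u k) x * pd m (pd k b) x * b x) +
      ((1/2) * (∫ x in Set.Icc (0 : Fin 3 → ℝ) (fun _ => L),
          (pd k (u k) x * (pd m b x * pd m b x))) +
        ∫ x in Set.Icc (0 : Fin 3 → ℝ) (fun _ => L),
          pd m (pd k (u k)) x * (pd m b x * b x)) := by
    intro k
    have iA := ((hA k).pd m).int
    have iB := ((hB k).pd k).int.const_mul (1/2)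
    have iC := ((hC k).pd k).int
    have iE := (hE k).int.const_mul (1/2)
    have iF := (hF k).int
    have iR := (hRk k).int
    simp_rw [pt k]
    refine (integral_add iR ((((iA.sub iB).sub iC).add iE).add iF)).trans ?_
    rw [integral_add' (((iA.sub iB).sub iC).add iE) iF,
      integral_add' ((iA.sub iB).sub iC) iE,
      integral_sub' (iA.sub iB) iC, integral_sub' iA iB, integral_const_mul, integral_const_mul,
      integral_pd hL (hA k), integral_pd hL (hB k), integral_pd hL (hC k)]
    ring
  simp_rw [step]
  rw [Finset.sum_add_distrib, Finset.sum_add_distrib, ← Finset.mul_sum,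
    ← integral_finsetSum _ (fun k _ => (hE k).int), ← integral_finsetSum _ (fun k _ => (hF k).int)]
  simp_rw [← Finset.sum_mul, hdiv, hdiv2]
  simp

/-- Integration-by-parts identity `∫ (u·∇)b·Δb = Σ_m ∫ (∂_m u·∇)∂_m b · b`
on the periodic box for divergence-free `u`. -/
theorem advection_laplacian_identity (L : ℝ) (hL : 0 < L)
    (u b : (Fin 3 → ℝ) → (Fin 3 → ℝ))
    (hu : ContDiff ℝ (⊤ : ℕ∞) u) (hb : ContDiff ℝ (⊤ : ℕ∞) b)
    (hu_per : ∀ (x : Fin 3 → ℝ) (i : Fin 3), u (x + Pi.single i L) = u x)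
    (hb_per : ∀ (x : Fin 3 → ℝ) (i : Fin 3), b (x + Pi.single i L) = b x)
    (hdiv : ∀ x : Fin 3 → ℝ, ∑ k, fderiv ℝ (fun y => u y k) x (Pi.single k 1) = 0) :
    ∫ x in Set.Icc (0 : Fin 3 → ℝ) (fun _ => L),
        ∑ k, ∑ l, ∑ m, u x k * fderiv ℝ (fun y => b y l) x (Pi.single k 1) *
          fderiv ℝ (fun y => fderiv ℝ (fun z => b z l) y (Pi.single m 1)) x (Pi.single m 1) =
      ∑ k : Fin 3, ∑ l : Fin 3, ∑ m : Fin 3,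
        ∫ x in Set.Icc (0 : Fin 3 → ℝ) (fun _ => L),
          fderiv ℝ (fun y => u y k) x (Pi.single m 1) *
            fderiv ℝ (fun y => fderiv ℝ (fun z => b z l) y (Pi.single k 1)) x (Pi.single m 1) *
            b x l := by
  have hU : ∀ k, SP L (fun y => u y k) := fun k =>
    ⟨contDiff_pi.1 hu k, fun x i => by simp only [hu_per]⟩
  have hB : ∀ l, SP L (fun y => b y l) := fun l =>
    ⟨contDiff_pi.1 hb l, fun x i => by simp only [hb_per]⟩
  have hI : ∀ k l m, IntegrableOn (fun x => u x k * fderiv ℝ (fun y => b y l) x (Pi.single k 1) *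
          fderiv ℝ (fun y => fderiv ℝ (fun z => b z l) y (Pi.single m 1)) x (Pi.single m 1))
          (Set.Icc (0 : Fin 3 → ℝ) (fun _ => L)) := fun k l m =>
    (((hU k).mul ((hB l).pd k)).mul (((hB l).pd m).pd m)).int
  have key := fun l m => main_term hL (fun k y => u y k) (fun y => b y l) hU (hB l) hdiv m
  rw [integral_finsetSum _ (fun k _ => integrable_finsetSum _ fun l _ =>
    integrable_finsetSum _ fun m _ => hI k l m)]
  simp_rw [integral_finsetSum _ (fun l _ => integrable_finsetSum _ fun m _ => hI _ l m),
    integral_finsetSum _ (fun m _ => hI _ _ m)]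
  have sw : ∀ F : Fin 3 → Fin 3 → Fin 3 → ℝ,
      ∑ k, ∑ l, ∑ m, F k l m = ∑ l, ∑ m, ∑ k, F k l m := by
    intro F
    rw [Finset.sum_comm]
    exact Finset.sum_congr rfl fun l _ => Finset.sum_comm
  refine (sw _).trans (Eq.trans ?_ (sw _).symm)
  exact Finset.sum_congr rfl fun l _ => Finset.sum_congr rfl fun m _ => key l m
end

section
/- Let L > 0, let α ≥ 1 be a real number, and let u : ℝ³ → ℝ³ be a smooth function that is L-periodic in each coordinate direction. Then − ∫_{[0,L]³} |u(x)|^{2α} u(x)·Δu(x) dx = ∫_{[0,L]³} |u(x)|^{2α} |∇u(x)|² dx + 2α ∫_{[0,L]³} |u(x)|^{2α−2} Σ_m (u(x)·∂_m u(x))² dx; in particular, − ∫_{[0,L]³} |u|^{2α} u·Δu dx ≥ ∫_{[0,L]³} |u|^{2α} |∇u|² dx. -/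
open MeasureTheory

/-- The integral over the periodic box of the divergence of a periodic field vanishes. -/
theorem integral_div_periodic (L : ℝ) (hL : 0 < L)
    (F : Fin 3 → (Fin 3 → ℝ) → ℝ) (F' : Fin 3 → (Fin 3 → ℝ) → (Fin 3 → ℝ) →L[ℝ] ℝ)
    (hF : ∀ m x, HasFDerivAt (F m) (F' m x) x)
    (hper : ∀ m x, F m (x + Pi.single m L) = F m x)
    (hc : Continuous fun x => ∑ m, F' m x (Pi.single m 1)) :
    ∫ x in Set.Icc (0 : Fin 3 → ℝ) (fun _ => L), ∑ m, F' m x (Pi.single m 1) = 0 := by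
  rw [integral_divergence_of_hasFDerivAt_off_countable' (0 : Fin 3 → ℝ) (fun _ => L)
    (fun _ => hL.le) F F' ∅ Set.countable_empty
    (fun i => (continuous_iff_continuousAt.2 fun x => (hF i x).continuousAt).continuousOn)
    (fun x _ i => hF i x) (hc.continuousOn.integrableOn_compact isCompact_Icc)]
  refine Finset.sum_eq_zero fun i _ => ?_
  rw [sub_eq_zero]
  congr 1
  funext x
  rw [← hper i (i.insertNth ((0 : Fin 3 → ℝ) i) x)]
  congr 1
  funext j
  rcases Fin.eq_self_or_eq_succAbove i j with rfl | ⟨k, rfl⟩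
  · simp
  · simp [Fin.succAbove_ne]

/-- Testing the damping term `|u|^{2α} u` against `−Δu` on the periodic box:
`−∫ |u|^{2α} u·Δu = ∫ |u|^{2α} |∇u|² + 2α ∫ |u|^{2α−2} Σ_m (u·∂_m u)²`, and in
particular `−∫ |u|^{2α} u·Δu ≥ ∫ |u|^{2α} |∇u|²`.  Here `|u(x)|² = Σ_l u_l(x)²`,
so `|u|^{2α} = (Σ_l u_l²)^α` and `|u|^{2α−2} = (Σ_l u_l²)^{α−1}`. -/
theorem damping_against_laplacian (L : ℝ) (hL : 0 < L) (α : ℝ) (hα : 1 ≤ α)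
    (u : (Fin 3 → ℝ) → (Fin 3 → ℝ)) (hu : ContDiff ℝ (⊤ : ℕ∞) u)
    (hu_per : ∀ (x : Fin 3 → ℝ) (i : Fin 3), u (x + Pi.single i L) = u x) :
    (-∫ x in Set.Icc (0 : Fin 3 → ℝ) (fun _ => L),
        (∑ l, u x l ^ 2) ^ α * ∑ l, u x l *
          ∑ m, fderiv ℝ (fun y => fderiv ℝ (fun z => u z l) y (Pi.single m 1)) x
            (Pi.single m 1) =
      (∫ x in Set.Icc (0 : Fin 3 → ℝ) (fun _ => L),
        (∑ l, u x l ^ 2) ^ α * ∑ m, ∑ l, fderiv ℝ (fun y => u y l) x (Pi.single m 1) ^ 2) +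
      2 * α * ∫ x in Set.Icc (0 : Fin 3 → ℝ) (fun _ => L),
        (∑ l, u x l ^ 2) ^ (α - 1) *
          ∑ m, (∑ l, u x l * fderiv ℝ (fun y => u y l) x (Pi.single m 1)) ^ 2) ∧
    (∫ x in Set.Icc (0 : Fin 3 → ℝ) (fun _ => L),
        (∑ l, u x l ^ 2) ^ α * ∑ m, ∑ l, fderiv ℝ (fun y => u y l) x (Pi.single m 1) ^ 2) ≤
      -∫ x in Set.Icc (0 : Fin 3 → ℝ) (fun _ => L),
        (∑ l, u x l ^ 2) ^ α * ∑ l, u x l *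
          ∑ m, fderiv ℝ (fun y => fderiv ℝ (fun z => u z l) y (Pi.single m 1)) x
            (Pi.single m 1) := by
  set K := Set.Icc (0 : Fin 3 → ℝ) (fun _ => L) with hK
  have hv : ∀ l, ContDiff ℝ (⊤ : ℕ∞) (fun z => u z l) := fun l => contDiff_pi.1 hu l
  have hd : ∀ m l, ContDiff ℝ (⊤ : ℕ∞)
      (fun y => fderiv ℝ (fun z => u z l) y (Pi.single m 1)) := fun m l =>
    ((hv l).fderiv_right (m := (⊤ : ℕ∞)) (by simp)).clm_apply contDiff_const
  have hdd : ∀ m l, Continuous (fun x => fderiv ℝ (fun y => fderiv ℝ (fun z => u z l) y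
      (Pi.single m 1)) x (Pi.single m 1)) := fun m l =>
    (((hd m l).fderiv_right (m := (⊤ : ℕ∞)) (by simp)).clm_apply contDiff_const).continuous
  have hdper : ∀ m l x i, fderiv ℝ (fun z => u z l) (x + Pi.single i L) (Pi.single m 1)
      = fderiv ℝ (fun z => u z l) x (Pi.single m 1) := by
    intro m l x i
    rw [← fderiv_comp_add_right]
    simp only [hu_per]
  have hvF : ∀ l x, HasFDerivAt (fun z => u z l) (fderiv ℝ (fun z => u z l) x) x := fun l x =>
    ((hv l).differentiable (by simp) x).hasFDerivAt
  have hdF := fun m l x => ((hd m l).differentiable (by simp) x).hasFDerivAt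
  have hvc := fun l => (hv l).continuous
  have hdc := fun m l => (hd m l).continuous
  generalize hD : (fun m l y => fderiv ℝ (fun z => u z l) y (Pi.single m 1)) = D
  have hD' : ∀ m l y, fderiv ℝ (fun z => u z l) y (Pi.single m 1) = D m l y := by
    intro m l y; rw [← hD]
  simp only [hD'] at hd hdd hdper hdF hdc ⊢
  have hs0 : ∀ x, 0 ≤ ∑ l, u x l ^ 2 := fun x => Finset.sum_nonneg fun l _ => sq_nonneg _
  have hsF : ∀ x, HasFDerivAt (fun z => ∑ l, u z l ^ 2)
      (∑ l, (2 * u x l) • fderiv ℝ (fun z => u z l) x) x := by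
    intro x
    refine HasFDerivAt.fun_sum fun l _ => ?_
    simpa using (hvF l x).pow 2
  have hpF := fun x => (hsF x).rpow_const (p := α) (Or.inr hα)
  have hgF : ∀ m x, HasFDerivAt (fun z => ∑ l, u z l * D m l z) _ x := fun m x =>
    HasFDerivAt.fun_sum fun l _ => (hvF l x).mul (hdF m l x)
  have hFF := fun m x => (hpF x).mul (hgF m x)
  have hpc : Continuous fun x => (∑ l, u x l ^ 2) ^ α :=
    Continuous.rpow_const (by fun_prop) fun x => Or.inr (by linarith)
  have hpc1 : Continuous fun x => (∑ l, u x l ^ 2) ^ (α - 1) :=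
    Continuous.rpow_const (by fun_prop) fun x => Or.inr (by linarith)
  have c1 : Continuous fun x => (∑ l, u x l ^ 2) ^ α * ∑ l, u x l *
      ∑ m, fderiv ℝ (fun y => D m l y) x (Pi.single m 1) := by fun_prop
  have c2 : Continuous fun x => (∑ l, u x l ^ 2) ^ α * ∑ m, ∑ l, D m l x ^ 2 := by fun_prop
  have c3 : Continuous fun x => (∑ l, u x l ^ 2) ^ (α - 1) *
      ∑ m, (∑ l, u x l * D m l x) ^ 2 := by fun_prop
  have i1 : IntegrableOn _ K volume := c1.continuousOn.integrableOn_compact isCompact_Icc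
  have i2 : IntegrableOn _ K volume := c2.continuousOn.integrableOn_compact isCompact_Icc
  have i3 : IntegrableOn _ K volume := c3.continuousOn.integrableOn_compact isCompact_Icc
  have key := integral_div_periodic L hL _ _ hFF
    (fun m x => by simp only [Pi.mul_apply, hu_per, hdper])
  have hfun : (fun x => ∑ m, ((∑ l, u x l ^ 2) ^ α • (∑ l, (u x l •
      fderiv ℝ (fun y => D m l y) x + D m l x • fderiv ℝ (fun z => u z l) x)) +
      (∑ l, u x l * D m l x) • ((α * (∑ l, u x l ^ 2) ^ (α - 1)) •
        ∑ l, (2 * u x l) • fderiv ℝ (fun z => u z l) x)) (Pi.single m 1)) = fun x =>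
      (((∑ l, u x l ^ 2) ^ α * ∑ l, u x l *
      ∑ m, fderiv ℝ (fun y => D m l y) x (Pi.single m 1))
      + (∑ l, u x l ^ 2) ^ α * ∑ m, ∑ l, D m l x ^ 2)
      + 2 * α * ((∑ l, u x l ^ 2) ^ (α - 1) * ∑ m, (∑ l, u x l * D m l x) ^ 2) := by
    funext x
    simp only [add_apply, smul_apply,
      sum_apply, smul_eq_mul, hD']
    generalize (∑ l, u x l ^ 2) ^ α = P
    generalize (∑ l, u x l ^ 2) ^ (α - 1) = Q
    simp only [Fin.sum_univ_three]
    ring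
  have key2 := key (by rw [hfun]; exact (c1.add c2).add (continuous_const.mul c3))
  rw [hfun] at key2
  have e1 := integral_add (i1.add i2) (i3.const_mul (2 * α))
  have e2 := integral_add i1 i2
  rw [integral_const_mul] at e1
  have e3 := e1.symm.trans key2
  simp only [Pi.add_apply] at e3
  rw [e2] at e3
  have hnn : 0 ≤ ∫ x in K, (∑ l, u x l ^ 2) ^ (α - 1) * ∑ m, (∑ l, u x l * D m l x) ^ 2 :=
    integral_nonneg fun x => mul_nonneg (Real.rpow_nonneg (hs0 x) _)
      (Finset.sum_nonneg fun m _ => sq_nonneg _)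
  have hnn2 := mul_nonneg (by linarith : 0 ≤ 2 * α) hnn
  constructor
  · linarith
  · linarith
end
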